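/- If S is a Coe-semigroup and x is a nonzero even element of S, then S_x = ({x} + S) ∪ {0} is a Coe-semigroup with maximal embedding dimension and multiplicity x. Conversely, every Coe-semigroup with maximal embedding dimension other than ℕ arises this way. -/

import Mathlib

open Pointwise

/-- A numerical semigroup: a submonoid of (ℕ,+) with finite complement. -/
def IsNumSgrp (S : Set ℕ) : Prop :=
  0 ∈ S ∧ (∀ a b, a ∈ S → b ∈ S → a + b ∈ S) ∧ {x : ℕ | x ∉ S}.Finite

/-- A Coe-semigroup: a numerical semigroup containing x-1 and x+1 for each odd x ∈ S. -/
def IsCoe (S : Set ℕ) : Prop :=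
  IsNumSgrp S ∧ ∀ x ∈ S, Odd x → x - 1 ∈ S ∧ x + 1 ∈ S

/-- The Frobenius number: the largest natural number not in S (for S ≠ ℕ). -/
noncomputable def frob (S : Set ℕ) : ℕ := sSup {x : ℕ | x ∉ S}

/-- The multiplicity: the least nonzero element of S. -/
noncomputable def mult (S : Set ℕ) : ℕ := sInf {x : ℕ | x ∈ S ∧ x ≠ 0}

/-- The genus: the number of gaps of S. -/
noncomputable def genus (S : Set ℕ) : ℕ := {x : ℕ | x ∉ S}.ncard

/-- The minimal system of generators of a numerical semigroup:
nonzero elements that are not a sum of two nonzero elements. -/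
def msg (S : Set ℕ) : Set ℕ :=
  (S \ {0}) \ {x | ∃ a ∈ S \ {0}, ∃ b ∈ S \ {0}, x = a + b}

theorem IsNumSgrp.exists_forall_gt_mem {T : Set ℕ} (hT : IsNumSgrp T) :
    ∃ B, ∀ n, B < n → n ∈ T := by
  obtain ⟨B, hB⟩ := hT.2.2.bddAbove
  refine ⟨B, fun n hn => ?_⟩
  by_contra h
  exact absurd (hB h) (by omega)

theorem IsNumSgrp.mult_mem {T : Set ℕ} (hT : IsNumSgrp T) : mult T ∈ T ∧ mult T ≠ 0 := by
  obtain ⟨B, hB⟩ := hT.exists_forall_gt_mem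
  exact Nat.sInf_mem (s := {x : ℕ | x ∈ T ∧ x ≠ 0}) ⟨B + 1, hB _ (by omega), by omega⟩

theorem mult_le {T : Set ℕ} {t : ℕ} (ht : t ∈ T) (h0 : t ≠ 0) : mult T ≤ t :=
  Nat.sInf_le (s := {x : ℕ | x ∈ T ∧ x ≠ 0}) ⟨ht, h0⟩

theorem IsNumSgrp.mul_mem {T : Set ℕ} (hT : IsNumSgrp T) {t : ℕ} (ht : t ∈ T) (k : ℕ) :
    t * k ∈ T := by
  induction k with
  | zero => exact hT.1
  | succ k ih => exact hT.2.1 _ _ ih ht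

theorem mem_msg {T : Set ℕ} {t : ℕ} :
    t ∈ msg T ↔ t ∈ T ∧ t ≠ 0 ∧ ∀ a ∈ T, a ≠ 0 → ∀ b ∈ T, b ≠ 0 → t ≠ a + b := by
  simp only [msg, Set.mem_sdiff, Set.mem_singleton_iff, Set.mem_ofPred_eq]
  constructor
  · rintro ⟨⟨h1, h2⟩, h3⟩
    exact ⟨h1, h2, fun a ha ha0 b hb hb0 h => h3 ⟨a, ⟨ha, ha0⟩, b, ⟨hb, hb0⟩, h⟩⟩
  · rintro ⟨h1, h2, h3⟩
    exact ⟨⟨h1, h2⟩, fun ⟨a, ⟨ha, ha0⟩, b, ⟨hb, hb0⟩, h⟩ => h3 a ha ha0 b hb hb0 h⟩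

/-- A minimal generator is at most every nonzero element of its class modulo the multiplicity. -/
theorem IsNumSgrp.le_of_mem_msg {T : Set ℕ} (hT : IsNumSgrp T) {a g : ℕ} (hg : g ∈ msg T)
    (ha : a ∈ T) (ha0 : a ≠ 0) (h : a % mult T = g % mult T) : g ≤ a := by
  by_contra! hlt
  obtain ⟨k, hk⟩ := (Nat.modEq_iff_dvd' hlt.le).1 h
  exact (mem_msg.1 hg).2.2 a ha ha0 (mult T * k) (hT.mul_mem hT.mult_mem.1 k) (by omega) (by omega)

theorem IsNumSgrp.injOn_msg {T : Set ℕ} (hT : IsNumSgrp T) :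
    Set.InjOn (· % mult T) (msg T) := fun _ ha _ hb h =>
  le_antisymm
    (hT.le_of_mem_msg ha (mem_msg.1 hb).1 (mem_msg.1 hb).2.1 h.symm)
    (hT.le_of_mem_msg hb (mem_msg.1 ha).1 (mem_msg.1 ha).2.1 h)

theorem IsNumSgrp.ncard_msg_eq_mult_iff_image {T : Set ℕ} (hT : IsNumSgrp T) :
    (msg T).ncard = mult T ↔ (· % mult T) '' msg T = Set.Iio (mult T) := by
  have hsub : (· % mult T) '' msg T ⊆ Set.Iio (mult T) := by
    rintro _ ⟨g, -, rfl⟩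
    exact Nat.mod_lt _ (Nat.pos_of_ne_zero hT.mult_mem.2)
  have hcard : (Set.Iio (mult T)).ncard = mult T := by
    rw [← Finset.coe_Iio, Set.ncard_coe_finset, Nat.card_Iio]
  rw [← hT.injOn_msg.ncard_image]
  constructor
  · intro h
    exact Set.eq_of_subset_of_ncard_le hsub (by rw [hcard, h]) (Set.finite_Iio _)
  · intro h
    rw [h, hcard]

/-- Maximal embedding dimension means that the sum of two nonzero elements, minus the
multiplicity, stays in the semigroup. -/
theorem IsNumSgrp.ncard_msg_eq_mult_iff {T : Set ℕ} (hT : IsNumSgrp T) :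
    (msg T).ncard = mult T ↔
      ∀ a ∈ T, a ≠ 0 → ∀ b ∈ T, b ≠ 0 → ∃ c ∈ T, a + b = mult T + c := by
  obtain ⟨hm, hm0⟩ := hT.mult_mem
  rw [hT.ncard_msg_eq_mult_iff_image]
  constructor
  · intro h a ha ha0 b hb hb0
    obtain ⟨g, hg, hgr⟩ : (a + b) % mult T ∈ (· % mult T) '' msg T := by
      rw [h]
      exact Nat.mod_lt _ (Nat.pos_of_ne_zero hm0)
    have hle := hT.le_of_mem_msg hg (hT.2.1 a b ha hb) (by omega) hgr.symm
    have hne := (mem_msg.1 hg).2.2 a ha ha0 b hb hb0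
    obtain ⟨k, hk⟩ := (Nat.modEq_iff_dvd' hle).1 hgr
    obtain _ | k := k
    · omega
    · refine ⟨g + mult T * k, hT.2.1 _ _ (mem_msg.1 hg).1 (hT.mul_mem hm k), ?_⟩
      rw [Nat.mul_succ] at hk
      omega
  · intro h
    refine Set.Subset.antisymm ?_ fun r (hr : r < mult T) => ?_
    · rintro _ ⟨g, -, rfl⟩
      exact Nat.mod_lt _ (Nat.pos_of_ne_zero hm0)
    · obtain ⟨B, hB⟩ := hT.exists_forall_gt_mem
      have hex : ∃ t, t ∈ T ∧ t ≠ 0 ∧ t % mult T = r := by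
        have hlt : B < r + mult T * (B + 1) := by nlinarith [Nat.pos_of_ne_zero hm0]
        refine ⟨r + mult T * (B + 1), hB _ hlt, by omega, ?_⟩
        rw [Nat.add_mul_mod_self_left, Nat.mod_eq_of_lt hr]
      classical
      obtain ⟨h1, h2, h3⟩ := Nat.find_spec hex
      refine ⟨Nat.find hex, mem_msg.2 ⟨h1, h2, fun a ha ha0 b hb hb0 hab => ?_⟩, h3⟩
      obtain ⟨c, hc, habc⟩ := h a ha ha0 b hb hb0
      have hle := mult_le ha ha0
      refine Nat.find_min hex (m := c) (by omega) ⟨hc, by omega, ?_⟩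
      rw [hab, habc, Nat.add_mod_left] at h3
      exact h3

theorem mem_singleton_add_union_zero {S : Set ℕ} {x t : ℕ} :
    t ∈ ({x} + S) ∪ {0} ↔ (∃ s ∈ S, t = x + s) ∨ t = 0 := by
  simp [eq_comm, or_comm]

theorem IsNumSgrp.singleton_add_union_zero {S : Set ℕ} (hS : IsNumSgrp S) {x : ℕ} (hx : x ∈ S) :
    IsNumSgrp (({x} + S) ∪ {0}) := by
  refine ⟨by simp, fun a b ha hb => ?_, ?_⟩
  · rw [mem_singleton_add_union_zero] at ha hb ⊢
    rcases ha with ⟨s, hs, rfl⟩ | rfl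
    · rcases hb with ⟨u, hu, rfl⟩ | rfl
      · exact Or.inl ⟨x + (s + u), hS.2.1 _ _ hx (hS.2.1 _ _ hs hu), by ring⟩
      · exact Or.inl ⟨s, hs, rfl⟩
    · simpa using hb
  · obtain ⟨B, hB⟩ := hS.exists_forall_gt_mem
    refine (Set.finite_Iic (x + B)).subset fun n hn => ?_
    by_contra hlt
    rw [Set.mem_Iic, not_le] at hlt
    exact hn (mem_singleton_add_union_zero.2 (Or.inl ⟨n - x, hB _ (by omega), by omega⟩))

theorem IsNumSgrp.mult_singleton_add_union_zero {S : Set ℕ} (hS : IsNumSgrp S) {x : ℕ}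
    (hx : x ∈ S) (hx0 : x ≠ 0) : mult (({x} + S) ∪ {0}) = x := by
  obtain ⟨hm, hm0⟩ := (hS.singleton_add_union_zero hx).mult_mem
  refine le_antisymm
    (mult_le (mem_singleton_add_union_zero.2 (Or.inl ⟨0, hS.1, by simp⟩)) hx0) ?_
  rcases mem_singleton_add_union_zero.1 hm with ⟨s, -, hs⟩ | h
  · omega
  · exact absurd h hm0

theorem IsCoe.singleton_add_union_zero {S : Set ℕ} (hS : IsCoe S) {x : ℕ} (hx : x ∈ S)
    (hxe : Even x) : IsCoe (({x} + S) ∪ {0}) := by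
  refine ⟨hS.1.singleton_add_union_zero hx, fun t ht hodd => ?_⟩
  rcases mem_singleton_add_union_zero.1 ht with ⟨s, hs, rfl⟩ | rfl
  · have hso : Odd s := by
      rcases hxe with ⟨y, rfl⟩
      rcases hodd with ⟨z, hz⟩
      exact ⟨z - y, by omega⟩
    have hpos := hso.pos
    obtain ⟨h1, h2⟩ := hS.2 s hs hso
    exact ⟨mem_singleton_add_union_zero.2 (Or.inl ⟨s - 1, h1, by omega⟩),
      mem_singleton_add_union_zero.2 (Or.inl ⟨s + 1, h2, by omega⟩)⟩
  · simp at hodd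

theorem IsNumSgrp.ncard_msg_singleton_add_union_zero {S : Set ℕ} (hS : IsNumSgrp S) {x : ℕ}
    (hx : x ∈ S) (hx0 : x ≠ 0) :
    (msg (({x} + S) ∪ {0})).ncard = mult (({x} + S) ∪ {0}) := by
  rw [(hS.singleton_add_union_zero hx).ncard_msg_eq_mult_iff,
    hS.mult_singleton_add_union_zero hx hx0]
  intro a ha ha0 b hb hb0
  rw [mem_singleton_add_union_zero] at ha hb
  obtain ⟨s, hs, rfl⟩ := ha.resolve_right ha0
  obtain ⟨u, hu, rfl⟩ := hb.resolve_right hb0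
  exact ⟨x + (s + u),
    mem_singleton_add_union_zero.2 (Or.inl ⟨s + u, hS.2.1 _ _ hs hu, rfl⟩), by ring⟩

theorem IsCoe.even_mult {T : Set ℕ} (hT : IsCoe T) (hne : T ≠ Set.univ) : Even (mult T) := by
  by_contra hodd
  rw [Nat.not_even_iff_odd] at hodd
  obtain ⟨hm, hm0⟩ := hT.1.mult_mem
  have hmem := (hT.2 _ hm hodd).1
  have hone : mult T = 1 := by
    by_contra h1
    have := mult_le hmem (by omega)
    omega
  refine hne (Set.eq_univ_of_forall fun n => ?_)
  simpa [hone] using hT.1.mul_mem hm n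

theorem stmt_16 :
    (∀ (S : Set ℕ) (x : ℕ), IsCoe S → x ∈ S → x ≠ 0 → Even x →
      IsCoe (({x} + S) ∪ {0}) ∧ (msg (({x} + S) ∪ {0})).ncard = mult (({x} + S) ∪ {0}) ∧
        mult (({x} + S) ∪ {0}) = x) ∧
    (∀ T : Set ℕ, IsCoe T → (msg T).ncard = mult T → T ≠ Set.univ →
      ∃ (S : Set ℕ) (x : ℕ), IsCoe S ∧ x ∈ S ∧ x ≠ 0 ∧ Even x ∧
        T = ({x} + S) ∪ {0}) := by
  refine ⟨fun S x hS hx hx0 hxe => ⟨hS.singleton_add_union_zero hx hxe,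
    hS.1.ncard_msg_singleton_add_union_zero hx hx0,
    hS.1.mult_singleton_add_union_zero hx hx0⟩, fun T hT hmed hne => ?_⟩
  obtain ⟨hm, hm0⟩ := hT.1.mult_mem
  have heven := hT.even_mult hne
  rw [hT.1.ncard_msg_eq_mult_iff] at hmed
  refine ⟨{s | mult T + s ∈ T}, mult T, ⟨⟨hm, fun a b ha hb => ?_, ?_⟩, fun s hs hso => ?_⟩,
    hT.1.2.1 _ _ hm hm, hm0, heven, ?_⟩
  · obtain ⟨c, hc, h⟩ := hmed _ ha (by omega) _ hb (by omega)
    obtain rfl : c = mult T + (a + b) := by omega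
    exact hc
  · exact hT.1.2.2.preimage (add_right_injective (mult T)).injOn
  · obtain ⟨h1, h2⟩ := hT.2 _ hs (heven.add_odd hso)
    rw [Nat.add_sub_assoc hso.pos] at h1
    exact ⟨h1, h2⟩
  · ext t
    rw [mem_singleton_add_union_zero]
    constructor
    · intro ht
      by_cases h0 : t = 0
      · exact Or.inr h0
      · obtain ⟨s, rfl⟩ := Nat.exists_eq_add_of_le (mult_le ht h0)
        exact Or.inl ⟨s, ht, rfl⟩
    · rintro (⟨s, hs, rfl⟩ | rfl)
      · exact hs
      · exact hT.1.1
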